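/- Let ℓ ≥ 1, let R be a set of ℓ-recurrence, let (X,T) be a minimal system, and let U ⊆ X be a nonempty open set. Then R ∩ N^ℓ(U) is a set of ℓ-recurrence. -/

import Mathlib

/-- A system `(X,T)` is minimal if no nonempty proper closed subset `K` satisfies `T(K) = K`. -/
def IsMinimal {X : Type} [TopologicalSpace X] (T : X → X) : Prop :=
  ∀ K : Set X, IsClosed K → K.Nonempty → T '' K = K → K = Set.univ

/-- `N^ℓ(U) = {n ≥ 1 : U ∩ T⁻ⁿU ∩ T⁻²ⁿU ∩ ⋯ ∩ T^{-ℓn}U ≠ ∅}`. -/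
def RetTimes {X : Type} (T : X → X) (ℓ : ℕ) (U : Set X) : Set ℕ :=
  {n | 1 ≤ n ∧ ∃ x, ∀ j ≤ ℓ, T^[j * n] x ∈ U}

/-- `R` is a set of `ℓ`-recurrence. -/
def IsRecSet (ℓ : ℕ) (R : Set ℕ) : Prop :=
  ∀ (X : Type) [MetricSpace X] [CompactSpace X] (T : X ≃ₜ X),
    IsMinimal (⇑T) → ∀ U : Set X, IsOpen U → U.Nonempty →
      ∃ n ∈ R, n ∈ RetTimes (⇑T) ℓ U

/-- A nonempty compact system contains a minimal nonempty closed invariant subset. -/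
theorem exists_minimal_closed_invariant {Z : Type} [TopologicalSpace Z] [CompactSpace Z]
    [Nonempty Z] (F : Z ≃ₜ Z) :
    ∃ M : Set Z, Minimal (fun K : Set Z => IsClosed K ∧ K.Nonempty ∧ F ⁻¹' K = K) M := by
  obtain ⟨M, -, hM⟩ := zorn_superset_nonempty
    {K : Set Z | IsClosed K ∧ K.Nonempty ∧ F ⁻¹' K = K} (fun c hc hchain hne => by
      refine ⟨⋂₀ c, ⟨isClosed_sInter fun K hK => (hc hK).1, ?_, ?_⟩,
        fun K hK => Set.sInter_subset_of_mem hK⟩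
      · have : Nonempty c := hne.to_subtype
        exact IsCompact.nonempty_sInter_of_directed_nonempty_isCompact_isClosed
          (fun A hA B hB => (hchain.total hA hB).elim
            (fun h => ⟨A, hA, subset_rfl, h⟩) (fun h => ⟨B, hB, h, subset_rfl⟩))
          (fun K hK => (hc hK).2.1) (fun K hK => (hc hK).1.isCompact)
          (fun K hK => (hc hK).1)
      · ext z
        simp only [Set.mem_preimage, Set.mem_sInter]
        refine forall₂_congr fun K hK => ?_
        rw [← Set.mem_preimage, (hc hK).2.2])
    Set.univ ⟨isClosed_univ, Set.univ_nonempty, Set.preimage_univ⟩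
  exact ⟨M, hM⟩

/-- In a minimal system, every two-sided orbit meets every nonempty open set. -/
theorem IsMinimal.exists_zpow_mem {X : Type} [TopologicalSpace X] {T : X ≃ₜ X}
    (hT : IsMinimal (⇑T)) {U : Set X} (hU : IsOpen U) (hne : U.Nonempty) (x : X) :
    ∃ k : ℤ, (T ^ k) x ∈ U := by
  by_contra! h
  have hopen : IsOpen (⋃ k : ℤ, (T ^ k : X ≃ₜ X) ⁻¹' U) :=
    isOpen_iUnion fun k => hU.preimage (T ^ k : X ≃ₜ X).continuous
  have huniv := hT _ hopen.isClosed_compl ⟨x, by simpa using h⟩ (by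
    rw [← T.preimage_symm]
    ext z
    simp only [Set.mem_preimage, Set.mem_compl_iff, Set.mem_iUnion, not_exists]
    have key (k : ℤ) : (T ^ (k - 1)) z = (T ^ k) (T.symm z) := by
      rw [zpow_sub_one]; rfl
    refine ⟨fun hz k => ?_, fun hz k => key k ▸ hz (k - 1)⟩
    rw [← add_sub_cancel_right k 1, key]
    exact hz (k + 1))
  obtain ⟨u, hu⟩ := hne
  have hmem : u ∈ (⋃ k : ℤ, (T ^ k : X ≃ₜ X) ⁻¹' U)ᶜ := huniv ▸ Set.mem_univ u
  exact hmem (Set.mem_iUnion.2 ⟨0, by simpa using hu⟩)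

/-- The restriction of a homeomorphism to a minimal closed invariant set is minimal. -/
theorem isMinimal_subtype {Z : Type} [TopologicalSpace Z] {F : Z ≃ₜ Z} {M : Set Z}
    (hM : Minimal (fun K : Set Z => IsClosed K ∧ K.Nonempty ∧ F ⁻¹' K = K) M)
    (hF : ∀ z, z ∈ M ↔ F z ∈ M) :
    IsMinimal (⇑(F.subtype hF : M ≃ₜ M)) := by
  intro K hK hne hinv
  have himage : F '' (Subtype.val '' K) = Subtype.val '' K := by
    conv_rhs => rw [← hinv]
    simp only [Set.image_image]
    rfl
  have hle := hM.le_of_le (y := Subtype.val '' K)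
    ⟨hM.prop.1.isClosedEmbedding_subtypeVal.isClosedMap K hK, hne.image _, by
      conv_lhs => rw [← himage]
      exact F.injective.preimage_image _⟩ (by rintro _ ⟨z, -, rfl⟩; exact z.2)
  refine Set.eq_univ_of_forall fun z => ?_
  obtain ⟨w, hw, hwz⟩ := hle z.2
  exact Subtype.ext hwz ▸ hw

/-- Powers of `T` composed with a factor map intertwine the iterates of the two systems. -/
theorem zpow_semiconj_iterate {Z X : Type} [TopologicalSpace X] {G : Z → Z} {T : X ≃ₜ X}
    {f : Z → X} (hf : Function.Semiconj f G T) (k : ℤ) (m : ℕ) (z : Z) :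
    (T ^ k) (f (G^[m] z)) = T^[m] ((T ^ k) (f z)) := by
  have hcomm : Function.Commute (T ^ k : X ≃ₜ X) T := fun x =>
    DFunLike.congr_fun ((Commute.refl T).zpow_left k).eq x
  rw [(hf.iterate_right m).eq, (hcomm.iterate_right m).eq]

/-- If `R` is a set of `ℓ`-recurrence, `(X,T)` a minimal system, and `U` a nonempty open
subset of `X`, then `R ∩ N^ℓ(U)` is a set of `ℓ`-recurrence. -/
theorem recSet_inter_retTimes (ℓ : ℕ) (hℓ : 1 ≤ ℓ) (R : Set ℕ) (hR : ∀ n ∈ R, 1 ≤ n)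
    (hRec : IsRecSet ℓ R)
    (X : Type) [MetricSpace X] [CompactSpace X] (T : X ≃ₜ X) (hmin : IsMinimal (⇑T))
    (U : Set X) (hU : IsOpen U) (hUne : U.Nonempty) :
    IsRecSet ℓ (R ∩ RetTimes (⇑T) ℓ U) := by
  intro Y _ _ S hS V hV hVne
  have : Nonempty (X × Y) := ⟨(hUne.some, hVne.some)⟩
  obtain ⟨M, hM⟩ := exists_minimal_closed_invariant (T.prodCongr S)
  have hF : ∀ z, z ∈ M ↔ T.prodCongr S z ∈ M := fun z => by
    rw [← Set.mem_preimage, hM.prop.2.2]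
  have : CompactSpace M := isCompact_iff_compactSpace.1 hM.prop.1.isCompact
  obtain ⟨⟨x, y⟩, hxy⟩ := hM.prop.2.1
  obtain ⟨a, ha⟩ := hmin.exists_zpow_mem hU hUne x
  obtain ⟨b, hb⟩ := hS.exists_zpow_mem hV hVne y
  obtain ⟨n, hn, hn1, z, hz⟩ := hRec M ((T.prodCongr S).subtype hF) (isMinimal_subtype hM hF)
    {z | (T ^ a) z.1.1 ∈ U ∧ (S ^ b) z.1.2 ∈ V}
    ((hU.preimage ((T ^ a).continuous.comp (continuous_fst.comp continuous_subtype_val))).inter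
      (hV.preimage ((S ^ b).continuous.comp (continuous_snd.comp continuous_subtype_val))))
    ⟨⟨(x, y), hxy⟩, ha, hb⟩
  refine ⟨n, ⟨hn, hn1, (T ^ a) z.1.1, fun j hj => ?_⟩, hn1, (S ^ b) z.1.2, fun j hj => ?_⟩
  · rw [← zpow_semiconj_iterate (f := fun w : M => w.1.1)
      (G := (T.prodCongr S).subtype hF) (fun _ => rfl)]
    exact (hz j hj).1
  · rw [← zpow_semiconj_iterate (f := fun w : M => w.1.2)
      (G := (T.prodCongr S).subtype hF) (fun _ => rfl)]
    exact (hz j hj).2
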